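/- Let N be a finite subset of ℤ^d \ {0}, and for k = 1,...,d let D_k be the diagonal N×N matrix with (D_k)_{l,l} = i·l_k (where l_k is the k-th coordinate of the index l ∈ ℤ^d). Then every matrix B ∈ ℂ^{N×N} can be written as a finite sum B = Σ_{k=1}^d A_1^k ⋯ A_{R_k}^k D_k, where each A_r^k is a Toeplitz matrix indexed by N (its (n,l)-entry depends only on n−l). -/

import Mathlib

open scoped ComplexOrder

variable {d : ℕ}

/-- A matrix indexed by a finite set `N ⊂ ℤ^d` is Toeplitz if its `(n,l)` entry depends
only on `n - l`. -/
def IsToeplitz (N : Finset (Fin d → ℤ)) (A : Matrix {x // x ∈ N} {x // x ∈ N} ℂ) : Prop :=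
  ∃ a : (Fin d → ℤ) → ℂ, ∀ n l : {x // x ∈ N}, A n l = a ((n : Fin d → ℤ) - (l : Fin d → ℤ))

/-- The diagonal matrix `D_k` with entries `(D_k)_{l,l} = i l_k`. -/
noncomputable def Dmat (N : Finset (Fin d → ℤ)) (k : Fin d) :
    Matrix {x // x ∈ N} {x // x ∈ N} ℂ :=
  Matrix.diagonal fun l => Complex.I * ((l : Fin d → ℤ) k : ℂ)

namespace IsToeplitz

variable {N : Finset (Fin d → ℤ)} {A B : Matrix {x // x ∈ N} {x // x ∈ N} ℂ}

theorem add (hA : IsToeplitz N A) (hB : IsToeplitz N B) : IsToeplitz N (A + B) := by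
  obtain ⟨a, ha⟩ := hA
  obtain ⟨b, hb⟩ := hB
  exact ⟨fun x => a x + b x, fun n l => by simp [ha, hb]⟩

theorem smul (c : ℂ) (hA : IsToeplitz N A) : IsToeplitz N (c • A) := by
  obtain ⟨a, ha⟩ := hA
  exact ⟨fun x => c * a x, fun n l => by simp [ha]⟩

theorem one : IsToeplitz N 1 := by
  refine ⟨fun x => if x = 0 then 1 else 0, fun n l => ?_⟩
  simp only [Matrix.one_apply, sub_eq_zero, Subtype.ext_iff]

theorem transpose (hA : IsToeplitz N A) : IsToeplitz N A.transpose := by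
  obtain ⟨a, ha⟩ := hA
  exact ⟨fun x => a (-x), fun n l => by simp [ha]⟩

/-- A matrix unit is Toeplitz when no other pair of indices has the same difference. -/
theorem single {i j : {x // x ∈ N}}
    (h : ∀ a b : {x // x ∈ N}, (a : Fin d → ℤ) - b = i - j → a = i ∧ b = j) (t : ℂ) :
    IsToeplitz N (Matrix.single i j t) := by
  refine ⟨fun x => if x = (i : Fin d → ℤ) - j then t else 0, fun a b => ?_⟩
  rw [Matrix.single_apply]
  refine if_congr ⟨?_, fun hab => ?_⟩ rfl rfl
  · rintro ⟨rfl, rfl⟩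
    rfl
  · exact ⟨(h a b hab).1.symm, (h a b hab).2.symm⟩

end IsToeplitz

/-- The compression to `N` of the shift by `v`. -/
def shiftMatrix (N : Finset (Fin d → ℤ)) (v : Fin d → ℤ) :
    Matrix {x // x ∈ N} {x // x ∈ N} ℂ :=
  Matrix.of fun n l => if (n : Fin d → ℤ) - l = v then 1 else 0

theorem isToeplitz_shiftMatrix (N : Finset (Fin d → ℤ)) (v : Fin d → ℤ) :
    IsToeplitz N (shiftMatrix N v) :=
  ⟨fun x => if x = v then 1 else 0, fun _ _ => rfl⟩

/-- The monoid of products of Toeplitz matrices. -/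
def toeplitzProducts (N : Finset (Fin d → ℤ)) :
    Submonoid (Matrix {x // x ∈ N} {x // x ∈ N} ℂ) :=
  Submonoid.closure {A | IsToeplitz N A}

section Products

variable {N : Finset (Fin d → ℤ)}

theorem IsToeplitz.mem_toeplitzProducts {A : Matrix {x // x ∈ N} {x // x ∈ N} ℂ}
    (hA : IsToeplitz N A) : A ∈ toeplitzProducts N :=
  Submonoid.subset_closure hA

theorem transpose_mem_toeplitzProducts {A : Matrix {x // x ∈ N} {x // x ∈ N} ℂ}
    (hA : A ∈ toeplitzProducts N) : A.transpose ∈ toeplitzProducts N := by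
  induction hA using Submonoid.closure_induction with
  | mem A hA => exact (IsToeplitz.transpose hA).mem_toeplitzProducts
  | one => simp [one_mem]
  | mul A B _ _ hA hB =>
    rw [Matrix.transpose_mul]
    exact mul_mem hB hA

/-- The relation that all transvections at position `(i, j)` are products of Toeplitz matrices. -/
def TransvectionsMem (N : Finset (Fin d → ℤ)) (i j : {x // x ∈ N}) : Prop :=
  i ≠ j → ∀ t : ℂ, Matrix.transvection i j t ∈ toeplitzProducts N

theorem TransvectionsMem.symm {i j : {x // x ∈ N}} (h : TransvectionsMem N i j) :
    TransvectionsMem N j i := by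
  intro hji t
  have := transpose_mem_toeplitzProducts (h hji.symm t)
  simpa [Matrix.transvection, Matrix.transpose_add, Matrix.transpose_single] using this

theorem TransvectionsMem.trans {i j k : {x // x ∈ N}} (hij : TransvectionsMem N i j)
    (hjk : TransvectionsMem N j k) : TransvectionsMem N i k := by
  intro hik t
  by_cases h1 : i = j
  · subst h1
    exact hjk hik t
  by_cases h2 : j = k
  · subst h2
    exact hij hik t
  have key : Matrix.transvection i k t = Matrix.transvection i j t * Matrix.transvection j k 1 *
      Matrix.transvection i j (-t) * Matrix.transvection j k (-1) := by
    simp [Matrix.transvection, mul_add, add_mul, Matrix.single_mul_single_of_ne,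
      Ne.symm h1, Ne.symm h2, Ne.symm hik, ← Matrix.single_neg]
    abel
  rw [key]
  exact mul_mem (mul_mem (mul_mem (hij h1 t) (hjk h2 1)) (hij h1 (-t))) (hjk h2 (-1))

/-- The diagonal matrix with entry `s` at `i` and `1` elsewhere. -/
def dilation (N : Finset (Fin d → ℤ)) (i : {x // x ∈ N}) (s : ℂ) :
    Matrix {x // x ∈ N} {x // x ∈ N} ℂ :=
  1 + Matrix.single i i (s - 1)

theorem dilation_mem_of_single {i j : {x // x ∈ N}} (hij : i ≠ j)
    (h : ∀ t, IsToeplitz N (Matrix.single i j t)) (s : ℂ) :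
    dilation N j s ∈ toeplitzProducts N := by
  have hT : TransvectionsMem N i j := fun _ t => (IsToeplitz.one.add (h t)).mem_toeplitzProducts
  have hji : IsToeplitz N (Matrix.single j i (1 - s)) := by
    simpa [Matrix.transpose_single] using (h (1 - s)).transpose
  have key : dilation N j s = Matrix.transvection j i (-(1 - s)) *
      (1 + Matrix.single i j 1 + Matrix.single j i (1 - s)) * Matrix.transvection i j (-1) := by
    ext a b
    simp [dilation, Matrix.transvection, mul_add, add_mul, hij, hij.symm, Matrix.single_apply,
      Matrix.one_apply]
    grind
  rw [key]
  exact mul_mem (mul_mem (hT.symm hij.symm _)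
    ((IsToeplitz.one.add (h 1)).add hji).mem_toeplitzProducts) (hT hij _)

theorem dilation_mem_of_transvectionsMem {i j : {x // x ∈ N}} (h : TransvectionsMem N i j)
    {s : ℂ} (hs : dilation N i s ∈ toeplitzProducts N) : dilation N j s ∈ toeplitzProducts N := by
  by_cases hij : i = j
  · rwa [← hij]
  have hji : j ≠ i := Ne.symm hij
  have key : dilation N j s = Matrix.transvection j i (-(1 - s)) * Matrix.transvection i j 1 *
      dilation N i s * Matrix.transvection j i (1 - s) * Matrix.transvection i j (-1) := by
    ext a b
    simp [dilation, Matrix.transvection, mul_add, add_mul, hij, hji, Matrix.single_apply,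
      Matrix.one_apply]
    grind
  rw [key]
  exact mul_mem (mul_mem (mul_mem (mul_mem (h.symm hji _) (h hij _)) hs) (h.symm hji _)) (h hij _)

theorem diagonal_mem_toeplitzProducts (h : ∀ i s, dilation N i s ∈ toeplitzProducts N)
    (D : {x // x ∈ N} → ℂ) : Matrix.diagonal D ∈ toeplitzProducts N := by
  have hd : ∀ i s, dilation N i s = Matrix.diagonalRingHom _ ℂ (Function.update 1 i s) := by
    intro i s
    ext a b
    by_cases hab : a = b
    · subst hab
      by_cases hi : a = i
      · subst hi
        simp [dilation]
      · simp [dilation, hi, Ne.symm hi]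
    · simp [dilation, Matrix.single_apply, hab]
      grind
  have hD : D = ∏ i, Function.update (1 : {x // x ∈ N} → ℂ) i (D i) := by
    ext a
    rw [Finset.prod_apply, Finset.prod_eq_single a] <;> simp +contextual [Function.update_apply]
    grind
  have hmem : ∀ s : Finset {x // x ∈ N}, Matrix.diagonalRingHom _ ℂ
      (∏ i ∈ s, Function.update (1 : {x // x ∈ N} → ℂ) i (D i)) ∈ toeplitzProducts N := by
    intro s
    induction s using Finset.induction_on with
    | empty => simp only [Finset.prod_empty, map_one, one_mem]
    | insert a s ha ih =>
      rw [Finset.prod_insert ha, map_mul, ← hd]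
      exact mul_mem (h _ _) ih
  have := hmem Finset.univ
  rwa [← hD] at this

/-- Scaling row `i` of `1 + t S`, where `S` is the shift by `i - n`, isolates a transvection at
`(i, n)`, up to one at `(i, j)`. -/
theorem transvectionsMem_of_shift {i j n : {x // x ∈ N}} (hij : i ≠ j)
    (hT : TransvectionsMem N i j) (hd : ∀ s, dilation N i s ∈ toeplitzProducts N)
    (h1 : ∀ a : {x // x ∈ N}, (a : Fin d → ℤ) - i ≠ i - n)
    (h2 : ∀ a b : {x // x ∈ N},
      (a : Fin d → ℤ) - b = (i - n) + (i - n) → a = i ∧ b = j) :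
    TransvectionsMem N i n := by
  intro hin t
  set S := shiftMatrix N ((i : Fin d → ℤ) - n) with hS
  obtain ⟨c, hc⟩ : ∃ c, S * S = Matrix.single i j c := by
    refine ⟨(S * S) i j, ?_⟩
    ext a b
    by_cases hab : i = a ∧ j = b
    · obtain ⟨rfl, rfl⟩ := hab
      simp
    · rw [Matrix.single_apply, if_neg hab, Matrix.mul_apply]
      refine Finset.sum_eq_zero fun x _ => ?_
      simp only [hS, shiftMatrix, Matrix.of_apply]
      split_ifs with hax hxb
      · have := h2 a b (by rw [← hax]; nth_rewrite 2 [hax]; rw [← hxb]; abel)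
        exact absurd ⟨this.1.symm, this.2.symm⟩ hab
      all_goals simp
  have hSp : ∀ x, S * Matrix.single i i x = 0 := by
    intro x
    ext a b
    by_cases hb : b = i
    · subst hb
      simp [hS, shiftMatrix, h1 a]
    · simp [hb]
  have hpS : ∀ x, Matrix.single i i x * S = Matrix.single i n x := by
    intro x
    ext a b
    by_cases ha : a = i
    · subst ha
      simp only [hS, Matrix.single_mul_apply_same, shiftMatrix, Matrix.of_apply, sub_right_inj,
        Matrix.single_apply, Subtype.ext_iff, true_and, mul_ite, mul_one, mul_zero]
      grind
    · simp [ha, Ne.symm ha]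
  have heS : ∀ x, Matrix.single i n x * S = Matrix.single i j (x * c) := by
    intro x
    rw [← hpS, mul_assoc, hc, Matrix.single_mul_single_same]
  have hmem : ∀ x : ℂ, 1 + x • S ∈ toeplitzProducts N := fun x =>
    (IsToeplitz.one.add ((isToeplitz_shiftMatrix N _).smul x)).mem_toeplitzProducts
  have key : Matrix.transvection i n t = dilation N i 2 * (1 + t • S) * dilation N i (1 / 2) *
      (1 + (-t) • S) * Matrix.transvection i j (2 * t ^ 2 * c) := by
    have e1 : dilation N i 2 * (1 + t • S) * dilation N i (1 / 2) =
        1 + t • S + Matrix.single i n t := by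
      simp only [dilation, mul_add, add_mul, mul_one, one_mul, Matrix.mul_smul, Matrix.smul_mul,
        hpS, hSp, smul_zero, Matrix.single_mul_single_same,
        Matrix.single_mul_single_of_ne _ _ _ _ hin.symm]
      ext a b
      simp [Matrix.single_apply]
      grind
    have e2 : (1 + t • S + Matrix.single i n t) * (1 + (-t) • S) =
        1 + Matrix.single i n t + Matrix.single i j (-(2 * t ^ 2 * c)) := by
      simp only [mul_add, add_mul, mul_one, one_mul, Matrix.mul_smul, Matrix.smul_mul, heS, hc]
      ext a b
      simp [Matrix.single_apply]
      grind
    rw [e1, e2]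
    simp only [Matrix.transvection, mul_add, add_mul, mul_one, one_mul,
      Matrix.single_mul_single_of_ne _ _ _ _ hin.symm,
      Matrix.single_mul_single_of_ne _ _ _ _ hij.symm]
    rw [add_zero, add_zero, add_assoc, ← Matrix.single_add, neg_add_cancel, Matrix.single_zero,
      add_zero]
  rw [key]
  exact mul_mem (mul_mem (mul_mem (mul_mem (hd _) (hmem _)) (hd _)) (hmem _)) (hT hij _)

/-- Every matrix indexed by `N` is a product of Toeplitz matrices. -/
theorem toeplitzProducts_eq_top (N : Finset (Fin d → ℤ)) : toeplitzProducts N = ⊤ := by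
  rw [eq_top_iff]
  rintro B -
  rcases subsingleton_or_nontrivial {x // x ∈ N} with hN | hN
  · refine IsToeplitz.mem_toeplitzProducts ?_
    rcases isEmpty_or_nonempty {x // x ∈ N} with hE | ⟨⟨x⟩⟩
    · exact ⟨0, fun n => hE.elim n⟩
    · exact ⟨fun _ => B x x, fun n l => by rw [Subsingleton.elim n x, Subsingleton.elim l x]⟩
  obtain ⟨M, hM⟩ := Finite.exists_max fun x : {x // x ∈ N} => toLex (x : Fin d → ℤ)
  obtain ⟨m, hm⟩ := Finite.exists_min fun x : {x // x ∈ N} => toLex (x : Fin d → ℤ)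
  have inj : ∀ {a b : {x // x ∈ N}},
      toLex (a : Fin d → ℤ) = toLex (b : Fin d → ℤ) → a = b := fun h =>
    Subtype.ext (toLex.injective h)
  have hMm : M ≠ m := by
    rintro rfl
    obtain ⟨x, y, hxy⟩ := hN
    exact hxy (inj (((hM x).antisymm (hm x)).trans ((hM y).antisymm (hm y)).symm))
  have extremal : ∀ a b : {x // x ∈ N}, toLex (M : Fin d → ℤ) - toLex (m : Fin d → ℤ) ≤
      toLex (a : Fin d → ℤ) - toLex (b : Fin d → ℤ) → a = M ∧ b = m := by
    intro a b h
    have ha := hM a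
    have hb := hm b
    constructor
    · refine inj (ha.antisymm ?_)
      have := add_le_add h hb
      simpa using this
    · refine inj (le_antisymm ?_ hb)
      exact (sub_le_sub_iff_left _).1 (h.trans (sub_le_sub_right ha _))
  have single_Mm : ∀ t, IsToeplitz N (Matrix.single M m t) :=
    IsToeplitz.single fun a b h => extremal a b (congrArg toLex h).ge
  have single_mM : ∀ t, IsToeplitz N (Matrix.single m M t) := fun t => by
    simpa [Matrix.transpose_single] using (single_Mm t).transpose
  have hT : TransvectionsMem N M m := fun _ t =>
    (IsToeplitz.one.add (single_Mm t)).mem_toeplitzProducts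
  have hdM := dilation_mem_of_single hMm.symm single_mM
  have hdm := dilation_mem_of_single hMm single_Mm
  have hMn : ∀ n, TransvectionsMem N M n := by
    intro n
    by_cases hnM : n = M
    · exact fun h => absurd hnM.symm h
    by_cases hnm : n = m
    · rwa [hnm]
    have ltM : toLex (n : Fin d → ℤ) < toLex (M : Fin d → ℤ) :=
      (hM n).lt_of_ne fun h => hnM (inj h)
    have ltm : toLex (m : Fin d → ℤ) < toLex (n : Fin d → ℤ) :=
      (hm n).lt_of_ne fun h => hnm (inj h).symm
    rcases le_total (toLex (n : Fin d → ℤ) + toLex (n : Fin d → ℤ))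
        (toLex (M : Fin d → ℤ) + toLex (m : Fin d → ℤ)) with hn | hn
    · refine transvectionsMem_of_shift hMm hT hdM (fun a h => ?_) fun a b h => extremal a b ?_
      · have h' := congrArg toLex h
        simp only [toLex_sub] at h'
        exact absurd (h' ▸ sub_pos.2 ltM) (not_lt.2 (sub_nonpos.2 (hM a)))
      · have h' := congrArg toLex h
        simp only [toLex_sub, toLex_add] at h'
        rw [h', ← sub_nonneg]
        convert sub_nonneg.2 hn using 1
        abel
    · refine hT.trans (transvectionsMem_of_shift hMm.symm hT.symm hdm (fun a h => ?_)
        fun a b h => (extremal b a ?_).symm)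
      · have h' := congrArg toLex h
        simp only [toLex_sub] at h'
        exact absurd (h' ▸ sub_neg.2 ltm) (not_lt.2 (sub_nonneg.2 (hm a)))
      · have h' := congrArg toLex h
        simp only [toLex_sub, toLex_add] at h'
        rw [← neg_sub (toLex (a : Fin d → ℤ)), h', ← sub_nonneg]
        convert sub_nonneg.2 hn using 1
        abel
  refine Matrix.diagonal_transvection_induction (· ∈ toeplitzProducts N) B (fun D _ => ?_)
    (fun t => ?_) fun _ _ => mul_mem
  · exact diagonal_mem_toeplitzProducts
      (fun i s => dilation_mem_of_transvectionsMem (hMn i) (hdM s)) D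
  · exact (hMn t.i).symm.trans (hMn t.j) t.hij t.c

end Products

/-- If `0 ∉ N`, every matrix `B ∈ ℂ^{N×N}` is a finite sum
`B = Σ_{k=1}^d A_1^k ⋯ A_{R_k}^k D_k` with each `A_r^k` Toeplitz. -/
theorem matrix_eq_sum_toeplitz_prod_diagonal (N : Finset (Fin d → ℤ))
    (hN : (0 : Fin d → ℤ) ∉ N) (B : Matrix {x // x ∈ N} {x // x ∈ N} ℂ) :
    ∃ (R : Fin d → ℕ) (A : ∀ k : Fin d, Fin (R k) → Matrix {x // x ∈ N} {x // x ∈ N} ℂ),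
      (∀ k r, IsToeplitz N (A k r)) ∧
      B = ∑ k : Fin d, (List.ofFn (A k)).prod * Dmat N k := by
  classical
  have factor : ∀ C : Matrix {x // x ∈ N} {x // x ∈ N} ℂ, ∃ L : List _,
      (∀ A ∈ L, IsToeplitz N A) ∧ L.prod = C := fun C =>
    Submonoid.exists_list_of_mem_closure
      (show C ∈ toeplitzProducts N from toeplitzProducts_eq_top N ▸ Submonoid.mem_top C)
  have hne : ∀ l : {x // x ∈ N}, ∃ k, (l : Fin d → ℤ) k ≠ 0 := fun l =>
    Function.ne_iff.1 fun h => hN ((show (l : Fin d → ℤ) = 0 from h) ▸ l.2)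
  choose κ hκ using hne
  choose L hL hprod using fun k : Fin d => factor
    (Matrix.of fun n l => if κ l = k then B n l / (Complex.I * ((l : Fin d → ℤ) k : ℂ)) else 0)
  refine ⟨fun k => (L k).length, fun k => (L k).get, fun k r => hL k _ (List.get_mem _ _), ?_⟩
  ext n l
  simp only [List.ofFn_get, hprod, Matrix.sum_apply, Dmat, Matrix.mul_diagonal, Matrix.of_apply]
  rw [Finset.sum_eq_single (κ l) (fun k _ hk => by rw [if_neg hk.symm, zero_mul]) (by simp),
    if_pos rfl, div_mul_cancel₀]
  exact mul_ne_zero Complex.I_ne_zero (Int.cast_ne_zero.2 (hκ l))
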